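/- (Theorem 4, transverse instability on the stripe lattice with κ = −1.) Let e₀ ∈ l²(ℤ, ℝ) be the Kronecker delta sequence at site 0, and let K ⊂ {δ ∈ ℝ : (1 − 2δ)² < 15/4} be compact. There exist ε₀ > 0 and C > 0 such that for every ε ∈ (0, ε₀), every δ ∈ K, and every solution ψ ∈ l²(ℤ, ℝ) of the stationary 1D dNLS equation with μ = 1 satisfying ψ_m > 0 for all m and ‖ψ − e₀‖_{l²} ≤ 2ε, setting p = √(1/4 + εδ), there exist λ ∈ ℂ with Re λ > 0 and Im λ > 0 and a nonzero pair (U, W) ∈ l²(ℤ, ℂ)² with L₊(p)U = −λW, L₋(p)W = λU (stripe-lattice operators with μ = 1 and κ = −1), such that |λ − [ (3/4)i + (iε/15)(14 + 17δ) + (2ε/15)√(15 − 4(1 − 2δ)²) ]| ≤ Cε². Hence the line soliton is transversely unstable with a quartet of complex eigenvalues (λ, λ̄, −λ, −λ̄) for transverse wavenumbers p² near 1/4. -/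

import Mathlib

/-- The space of absolutely summable complex sequences indexed by `ℤ`. -/
abbrev IntEllOne : Type := lp (fun _ : ℤ => ℂ) 1

namespace IntEllOne

theorem summable_norm (x : IntEllOne) : Summable fun m => ‖x m‖ := by
  simpa using (lp.memℓp x).summable (by simp)

theorem norm_eq_tsum (x : IntEllOne) : ‖x‖ = ∑' m, ‖x m‖ := by
  simpa using lp.norm_eq_tsum_rpow (p := 1) (by simp) x

theorem memℓp_of_summable {x : ℤ → ℂ} (hx : Summable fun m => ‖x m‖) : Memℓp x 1 :=
  memℓp_gen (by simpa using hx)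

theorem memℓp_two (x : IntEllOne) : Memℓp (x : ℤ → ℂ) 2 :=
  (lp.memℓp x).of_exponent_ge (by norm_num)

theorem norm_coord_le (x : IntEllOne) (m : ℤ) : ‖x m‖ ≤ ‖x‖ :=
  lp.norm_apply_le_norm (by simp) x m

theorem summable_norm_weighted {w : ℤ → ℂ} {C : ℝ} (hw : ∀ m, ‖w m‖ ≤ C) (k : ℤ)
    (x : IntEllOne) : Summable fun m => ‖w m * x (m + k)‖ := by
  have h : Summable fun m => C * ‖x (m + k)‖ :=
    ((Equiv.addRight k).summable_iff.mpr x.summable_norm).mul_left C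
  refine Summable.of_nonneg_of_le (fun _ => norm_nonneg _) (fun m => ?_) h
  rw [norm_mul]
  exact mul_le_mul_of_nonneg_right (hw m) (norm_nonneg _)

theorem tsum_norm_weighted_le {w : ℤ → ℂ} {C : ℝ} (hw : ∀ m, ‖w m‖ ≤ C) (k : ℤ)
    (x : IntEllOne) : ∑' m, ‖w m * x (m + k)‖ ≤ C * ‖x‖ := by
  have h : Summable fun m => C * ‖x (m + k)‖ :=
    ((Equiv.addRight k).summable_iff.mpr x.summable_norm).mul_left C
  calc ∑' m, ‖w m * x (m + k)‖ ≤ ∑' m, C * ‖x (m + k)‖ := by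
        refine (summable_norm_weighted hw k x).tsum_le_tsum (fun m => ?_) h
        rw [norm_mul]
        exact mul_le_mul_of_nonneg_right (hw m) (norm_nonneg _)
    _ = C * ‖x‖ := by
        rw [tsum_mul_left, norm_eq_tsum]
        congr 1
        exact (Equiv.addRight k).tsum_eq fun m => ‖x m‖

/-- The operator `x ↦ (w m * x (m + k))ₘ` for a bounded weight `w`. -/
noncomputable def weightedShift (w : ℤ → ℂ) (C : ℝ) (hw : ∀ m, ‖w m‖ ≤ C) (k : ℤ) :
    IntEllOne →L[ℂ] IntEllOne :=
  LinearMap.mkContinuous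
    { toFun := fun x =>
        (⟨fun m => w m * x (m + k), memℓp_of_summable (summable_norm_weighted hw k x)⟩ : IntEllOne)
      map_add' := fun x y => by
        apply lp.ext; funext m
        exact mul_add (w m) (x (m + k)) (y (m + k))
      map_smul' := fun c x => by
        apply lp.ext; funext m
        exact mul_left_comm (w m) c (x (m + k)) }
    C (fun x => by
      rw [norm_eq_tsum]
      exact tsum_norm_weighted_le hw k x)

theorem weightedShift_apply (w : ℤ → ℂ) (C : ℝ) (hw : ∀ m, ‖w m‖ ≤ C) (k : ℤ)
    (x : IntEllOne) (m : ℤ) : weightedShift w C hw k x m = w m * x (m + k) := rfl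

theorem norm_weightedShift_le (w : ℤ → ℂ) (C : ℝ) (hw : ∀ m, ‖w m‖ ≤ C) (k : ℤ) :
    ‖weightedShift w C hw k‖ ≤ C :=
  LinearMap.mkContinuous_norm_le _ ((norm_nonneg _).trans (hw 0)) _

/-- The translation `x ↦ (x (m + k))ₘ`. -/
noncomputable def shift (k : ℤ) : IntEllOne →L[ℂ] IntEllOne :=
  weightedShift 1 1 (by simp) k

@[simp] theorem shift_apply (k : ℤ) (x : IntEllOne) (m : ℤ) : shift k x m = x (m + k) := by
  simp [shift, weightedShift_apply]

theorem norm_shift_le (k : ℤ) : ‖shift k‖ ≤ 1 := norm_weightedShift_le _ _ _ _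

/-- Evaluation at the origin. -/
noncomputable def evalZero : IntEllOne →L[ℂ] ℂ :=
  LinearMap.mkContinuous
    { toFun := fun x => x 0
      map_add' := fun _ _ => rfl
      map_smul' := fun _ _ => rfl } 1
    (fun x => by rw [one_mul]; exact norm_coord_le x 0)

/-- The sequence supported at the origin with value one. -/
noncomputable def unitZero : IntEllOne := lp.single 1 0 1

theorem unitZero_apply (m : ℤ) : unitZero m = if m = 0 then 1 else 0 := by
  simp [unitZero, Pi.single_apply]

theorem norm_unitZero : ‖unitZero‖ = 1 := by
  simp [unitZero, lp.norm_single]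

instance : Nontrivial IntEllOne :=
  ⟨unitZero, 0, fun h => by simpa [h] using norm_unitZero⟩

end IntEllOne

section NeumannInverse

variable {A : Type*} [NormedRing A] [CompleteSpace A]

theorem norm_inverse_one_sub_mul_le [NormOneClass A] {t : A} (h : ‖t‖ < 1) :
    ‖Ring.inverse (1 - t)‖ * (1 - ‖t‖) ≤ 1 := by
  have h1 : Ring.inverse (1 - t) = 1 + t * Ring.inverse (1 - t) := by
    have := Ring.mul_inverse_cancel _ (isUnit_one_sub_of_norm_lt_one h)
    rw [sub_mul, one_mul] at this
    exact eq_add_of_sub_eq this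
  have h2 : ‖Ring.inverse (1 - t)‖ ≤ 1 + ‖t‖ * ‖Ring.inverse (1 - t)‖ := by
    calc ‖Ring.inverse (1 - t)‖ = ‖1 + t * Ring.inverse (1 - t)‖ := by rw [← h1]
      _ ≤ ‖(1 : A)‖ + ‖t * Ring.inverse (1 - t)‖ := norm_add_le _ _
      _ ≤ 1 + ‖t‖ * ‖Ring.inverse (1 - t)‖ := by
          rw [norm_one]; gcongr; exact norm_mul_le _ _
  linarith

theorem norm_inverse_one_sub_le_two [NormOneClass A] {t : A} (h : ‖t‖ ≤ 1 / 2) :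
    ‖Ring.inverse (1 - t)‖ ≤ 2 := by
  have h1 := norm_inverse_one_sub_mul_le (t := t) (by linarith)
  nlinarith [norm_nonneg (Ring.inverse (1 - t))]

theorem DifferentiableAt.inverse_one_sub [NormedAlgebra ℂ A] {f : ℂ → A} {z : ℂ}
    (hf : DifferentiableAt ℂ f z) (h : ‖f z‖ < 1) :
    DifferentiableAt ℂ (fun u => Ring.inverse (1 - f u)) z := by
  have h1 : DifferentiableAt ℂ (fun u => 1 - f u) z := (differentiableAt_const 1).sub hf
  exact DifferentiableAt.comp z (f := fun u => 1 - f u)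
    (differentiableAt_inverse (isUnit_one_sub_of_norm_lt_one h)) h1

end NeumannInverse

namespace IntEllOne

/-- The resolvent `(z + z⁻¹ - S - S⁻¹)⁻¹` of the lattice Laplacian, in the uniformising
coordinate `z` of the unit disc. -/
noncomputable def resolvent (z : ℂ) : IntEllOne →L[ℂ] IntEllOne :=
  z • (Ring.inverse (1 - z • shift (-1)) * Ring.inverse (1 - z • shift 1))

theorem norm_smul_shift_le (z : ℂ) (k : ℤ) : ‖z • shift k‖ ≤ ‖z‖ := by
  rw [norm_smul]
  exact mul_le_of_le_one_right (norm_nonneg _) (norm_shift_le k)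

theorem norm_inverse_one_sub_smul_shift_le {z : ℂ} (hz : ‖z‖ ≤ 4 / 5) (k : ℤ) :
    ‖Ring.inverse (1 - z • shift k)‖ ≤ 5 := by
  have h1 := norm_smul_shift_le z k
  have h2 := norm_inverse_one_sub_mul_le (t := z • shift k) (by linarith)
  nlinarith [norm_nonneg (Ring.inverse (1 - z • shift k))]

theorem norm_resolvent_le {z : ℂ} (hz : ‖z‖ ≤ 4 / 5) : ‖resolvent z‖ ≤ 20 := by
  have h1 := norm_inverse_one_sub_smul_shift_le hz (-1)
  have h2 := norm_inverse_one_sub_smul_shift_le hz 1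
  calc ‖resolvent z‖ ≤ ‖z‖ * (‖Ring.inverse (1 - z • shift (-1))‖ *
        ‖Ring.inverse (1 - z • shift 1)‖) := by
        rw [resolvent, norm_smul]; gcongr; exact norm_mul_le _ _
    _ ≤ 4 / 5 * (5 * 5) := by gcongr
    _ = 20 := by norm_num

theorem differentiableAt_resolvent {z : ℂ} (hz : ‖z‖ ≤ 4 / 5) :
    DifferentiableAt ℂ resolvent z := by
  have h (k : ℤ) : DifferentiableAt ℂ (fun u : ℂ => Ring.inverse (1 - u • shift k)) z :=
    (differentiableAt_id.smul_const (shift k)).inverse_one_sub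
      ((norm_smul_shift_le z k).trans_lt (by linarith))
  exact differentiableAt_id.smul ((h (-1)).mul (h 1))

theorem factor_mul_resolvent {z : ℂ} (hz : ‖z‖ ≤ 4 / 5) :
    (1 - z • shift 1) * (1 - z • shift (-1)) * resolvent z = z • 1 := by
  have hu (k : ℤ) : IsUnit (1 - z • shift k) :=
    isUnit_one_sub_of_norm_lt_one ((norm_smul_shift_le z k).trans_lt (by linarith))
  rw [resolvent, mul_smul_comm, mul_assoc, ← mul_assoc (1 - z • shift (-1)),
    Ring.mul_inverse_cancel _ (hu _), one_mul, Ring.mul_inverse_cancel _ (hu _)]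

theorem resolvent_mul_factor {z : ℂ} (hz : ‖z‖ ≤ 4 / 5) :
    resolvent z * ((1 - z • shift 1) * (1 - z • shift (-1))) = z • 1 := by
  have hu (k : ℤ) : IsUnit (1 - z • shift k) :=
    isUnit_one_sub_of_norm_lt_one ((norm_smul_shift_le z k).trans_lt (by linarith))
  rw [resolvent, smul_mul_assoc, mul_assoc, ← mul_assoc (Ring.inverse (1 - z • shift 1)),
    Ring.inverse_mul_cancel _ (hu _), one_mul, Ring.inverse_mul_cancel _ (hu _)]

theorem factor_apply (z : ℂ) (x : IntEllOne) (m : ℤ) :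
    ((1 - z • shift 1) * (1 - z • shift (-1))) x m
      = (1 + z ^ 2) * x m - z * (x (m + 1) + x (m - 1)) := by
  change (x m - z * shift (-1) x m) - z * shift 1 (x - z • shift (-1) x) m = _
  rw [shift_apply, shift_apply]
  change (x m - z * _) - z * (x (m + 1) - z * shift (-1) x (m + 1)) = _
  rw [shift_apply, add_neg_cancel_right, ← sub_eq_add_neg]
  ring

theorem resolvent_equation {z : ℂ} (hz : ‖z‖ ≤ 4 / 5) (x : IntEllOne) (m : ℤ) :
    (1 + z ^ 2) * resolvent z x m - z * (resolvent z x (m + 1) + resolvent z x (m - 1))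
      = z * x m := by
  rw [← factor_apply]
  have h := congrArg (fun T : IntEllOne →L[ℂ] IntEllOne => T x m) (factor_mul_resolvent hz)
  exact h

theorem summable_norm_pow_natAbs {z : ℂ} (hz : ‖z‖ < 1) :
    Summable fun m : ℤ => ‖z ^ m.natAbs‖ := by
  have h : Summable fun n : ℕ => ‖z ^ n‖ := by
    simpa using summable_geometric_of_lt_one (norm_nonneg z) hz
  exact Summable.of_nat_of_neg (by simpa using h) (by simpa using h)

theorem resolvent_unitZero_zero {z : ℂ} (hz : ‖z‖ ≤ 4 / 5) :
    (1 - z ^ 2) * resolvent z unitZero 0 = z := by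
  let Φ : IntEllOne :=
    ⟨fun m => z ^ m.natAbs, memℓp_of_summable (summable_norm_pow_natAbs (by linarith))⟩
  have hΦ : ((1 - z • shift 1) * (1 - z • shift (-1))) Φ = (1 - z ^ 2) • unitZero := by
    apply lp.ext
    funext m
    rw [factor_apply]
    change (1 + z ^ 2) * z ^ m.natAbs - z * (z ^ (m + 1).natAbs + z ^ (m - 1).natAbs)
      = (1 - z ^ 2) * unitZero m
    rw [unitZero_apply]
    rcases lt_trichotomy m 0 with h | h | h
    · obtain ⟨n, rfl⟩ : ∃ n : ℕ, m = -(n + 1 : ℤ) := ⟨(-m - 1).toNat, by omega⟩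
      rw [if_neg h.ne, show (-(n + 1 : ℤ)).natAbs = n + 1 by omega,
        show (-(n + 1 : ℤ) + 1).natAbs = n by omega,
        show (-(n + 1 : ℤ) - 1).natAbs = n + 2 by omega]
      ring
    · subst h
      simp
      ring
    · obtain ⟨n, rfl⟩ : ∃ n : ℕ, m = (n + 1 : ℤ) := ⟨(m - 1).toNat, by omega⟩
      rw [if_neg h.ne', show ((n + 1 : ℤ)).natAbs = n + 1 by omega,
        show ((n + 1 : ℤ) + 1).natAbs = n + 2 by omega,
        show ((n + 1 : ℤ) - 1).natAbs = n by omega]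
      ring
  have h1 := congrArg (fun T : IntEllOne →L[ℂ] IntEllOne => T Φ 0) (resolvent_mul_factor hz)
  change resolvent z (((1 - z • shift 1) * (1 - z • shift (-1))) Φ) 0 = z * Φ 0 at h1
  rw [hΦ, map_smul] at h1
  change (1 - z ^ 2) * resolvent z unitZero 0 = z * z ^ (0 : ℤ).natAbs at h1
  simpa using h1

end IntEllOne

namespace IntEllOne

/-- The rank-one projection onto the origin. -/
noncomputable def projZero : IntEllOne →L[ℂ] IntEllOne := evalZero.smulRight unitZero

theorem projZero_apply (x : IntEllOne) : projZero x = x 0 • unitZero := rfl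

theorem norm_projZero_le : ‖projZero‖ ≤ 1 := by
  refine ContinuousLinearMap.opNorm_le_bound _ zero_le_one fun x => ?_
  rw [projZero_apply, norm_smul, norm_unitZero, mul_one, one_mul]
  exact norm_coord_le x 0

/-- The `2 × 2` block system left after removing the resonant resolvent has a unique solution
depending analytically on the spectral parameter. -/
theorem exists_analytic_solution {w : ℤ → ℂ} {ε g : ℝ} {k : ℂ → ℂ} (hε : 0 < ε)
    (hε' : ε ≤ 1 / 2000) (hw : ∀ m, ‖w m‖ ≤ 4 * ε) (hg : |g| ≤ 2) :
    ∃ a b : ℂ → IntEllOne, ∀ z : ℂ, ‖z‖ ≤ 4 / 5 → DifferentiableAt ℂ k z → 1 ≤ ‖k z‖ →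
      DifferentiableAt ℂ a z ∧ DifferentiableAt ℂ b z ∧ ‖a z‖ ≤ 400 ∧ ‖b z‖ ≤ 1000 ∧
      (∃ c : IntEllOne, a z = resolvent z c ∧
        ∀ m, c m = g * unitZero m + w m * (2 * a z m + b z m)) ∧
      ∀ m, k z * b z m = ε * (b z (m + 1) + b z (m - 1)) + ε * (w m * (a z m + 2 * b z m))
        + g * (2 * ε - 3 * a z 0) * unitZero m := by
  set M := weightedShift w (4 * ε) hw 0 with hM
  have hMn : ‖M‖ ≤ 4 * ε := norm_weightedShift_le _ _ _ _
  have hgC : ‖(g : ℂ)‖ ≤ 2 := by simpa using hg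
  have hεC : ‖(ε : ℂ)‖ = ε := by simp [abs_of_pos hε]
  let T : ℂ → IntEllOne →L[ℂ] IntEllOne := fun z => (2 : ℂ) • (M * resolvent z)
  let Q : ℂ → IntEllOne →L[ℂ] IntEllOne := fun z => resolvent z * Ring.inverse (1 - T z)
  let B : ℂ → IntEllOne →L[ℂ] IntEllOne := fun z =>
    (ε : ℂ) • (shift 1 + shift (-1)) + (ε : ℂ) • (M * Q z * M) + (ε : ℂ) • ((2 : ℂ) • M)
      - (g : ℂ) • ((3 : ℂ) • (projZero * Q z * M))
  let v : IntEllOne := (g : ℂ) • unitZero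
  let s : ℂ → IntEllOne := fun z => (ε : ℂ) • M (Q z v) + (ε : ℂ) • (2 : ℂ) • v
    - (g : ℂ) • (3 : ℂ) • projZero (Q z v)
  let b : ℂ → IntEllOne := fun z => Ring.inverse (1 - (k z)⁻¹ • B z) ((k z)⁻¹ • s z)
  let a : ℂ → IntEllOne := fun z => Q z (v + M (b z))
  have hv : ‖v‖ ≤ 2 := by
    rw [norm_smul, norm_unitZero, mul_one]; exact hgC
  refine ⟨a, b, fun z hz hkd hk => ?_⟩
  have hk0 : k z ≠ 0 := by
    intro h; rw [h, norm_zero] at hk; linarith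
  have hkinv : ‖(k z)⁻¹‖ ≤ 1 := by
    rw [norm_inv]; exact inv_le_one_of_one_le₀ hk
  have hR := norm_resolvent_le hz
  have hT : ‖T z‖ ≤ 1 / 2 := by
    calc ‖T z‖ ≤ 2 * (‖M‖ * ‖resolvent z‖) := by
          simp only [T]; rw [norm_smul]; norm_num
          exact norm_mul_le _ _
      _ ≤ 2 * (4 * ε * 20) := by gcongr
      _ ≤ 1 / 2 := by linarith
  have hQ : ‖Q z‖ ≤ 40 := by
    calc ‖Q z‖ ≤ ‖resolvent z‖ * ‖Ring.inverse (1 - T z)‖ := norm_mul_le _ _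
      _ ≤ 20 * 2 := by
          gcongr
          exact norm_inverse_one_sub_le_two hT
      _ = 40 := by norm_num
  have hMQ : ‖M * Q z‖ ≤ 4 * ε * 40 := (norm_mul_le _ _).trans (by gcongr)
  have hPQ : ‖projZero * Q z‖ ≤ 1 * 40 :=
    (norm_mul_le _ _).trans (by gcongr; exact norm_projZero_le)
  have hB : ‖B z‖ ≤ 1 / 2 := by
    have e1 : ‖(ε : ℂ) • (shift 1 + shift (-1))‖ ≤ ε * (1 + 1) := by
      rw [norm_smul, hεC]
      gcongr
      exact (norm_add_le _ _).trans (add_le_add (norm_shift_le _) (norm_shift_le _))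
    have e2 : ‖(ε : ℂ) • (M * Q z * M)‖ ≤ ε * (4 * ε * 40 * (4 * ε)) := by
      rw [norm_smul, hεC]
      gcongr
      exact (norm_mul_le _ _).trans (by gcongr)
    have e3 : ‖(ε : ℂ) • ((2 : ℂ) • M)‖ ≤ ε * (2 * (4 * ε)) := by
      rw [norm_smul, norm_smul, hεC, Complex.norm_ofNat]
      gcongr
    have e4 : ‖(g : ℂ) • ((3 : ℂ) • (projZero * Q z * M))‖ ≤ 2 * (3 * (1 * 40 * (4 * ε))) := by
      rw [norm_smul, norm_smul, Complex.norm_ofNat]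
      gcongr
      exact (norm_mul_le _ _).trans (by gcongr)
    calc ‖B z‖ ≤ ‖(ε : ℂ) • (shift 1 + shift (-1))‖ + ‖(ε : ℂ) • (M * Q z * M)‖
          + ‖(ε : ℂ) • ((2 : ℂ) • M)‖ + ‖(g : ℂ) • ((3 : ℂ) • (projZero * Q z * M))‖ :=
          (norm_sub_le _ _).trans (add_le_add_left (norm_add₃_le) _)
      _ ≤ ε * (1 + 1) + ε * (4 * ε * 40 * (4 * ε)) + ε * (2 * (4 * ε))
          + 2 * (3 * (1 * 40 * (4 * ε))) := by gcongr
      _ ≤ 1 / 2 := by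
          have : ε * ε ≤ ε * (1 / 2000) := by gcongr
          have : ε * ε * ε ≤ ε * (1 / 2000) * (1 / 2000) := by gcongr
          nlinarith
  have hkB : ‖(k z)⁻¹ • B z‖ ≤ 1 / 2 := by
    rw [norm_smul]
    nlinarith [norm_nonneg (B z)]
  have hQv : ‖Q z v‖ ≤ 40 * 2 := (ContinuousLinearMap.le_opNorm _ _).trans (by gcongr)
  have hs : ‖s z‖ ≤ 500 := by
    have e1 : ‖(ε : ℂ) • M (Q z v)‖ ≤ ε * (4 * ε * (40 * 2)) := by
      rw [norm_smul, hεC]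
      gcongr
      exact (ContinuousLinearMap.le_opNorm _ _).trans (by gcongr)
    have e2 : ‖(ε : ℂ) • (2 : ℂ) • v‖ ≤ ε * (2 * 2) := by
      rw [norm_smul, norm_smul, hεC, Complex.norm_ofNat]
      gcongr
    have e3 : ‖(g : ℂ) • (3 : ℂ) • projZero (Q z v)‖ ≤ 2 * (3 * (1 * (40 * 2))) := by
      rw [norm_smul, norm_smul, Complex.norm_ofNat]
      gcongr
      exact (ContinuousLinearMap.le_opNorm _ _).trans (by gcongr; exact norm_projZero_le)
    calc ‖s z‖ ≤ ‖(ε : ℂ) • M (Q z v)‖ + ‖(ε : ℂ) • (2 : ℂ) • v‖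
          + ‖(g : ℂ) • (3 : ℂ) • projZero (Q z v)‖ :=
          (norm_sub_le _ _).trans (add_le_add_left (norm_add_le _ _) _)
      _ ≤ ε * (4 * ε * (40 * 2)) + ε * (2 * 2) + 2 * (3 * (1 * (40 * 2))) := by gcongr
      _ ≤ 500 := by nlinarith
  have hb : ‖b z‖ ≤ 1000 := by
    calc ‖b z‖ ≤ ‖Ring.inverse (1 - (k z)⁻¹ • B z)‖ * ‖(k z)⁻¹ • s z‖ :=
          ContinuousLinearMap.le_opNorm _ _
      _ ≤ 2 * (1 * 500) := by
          rw [norm_smul]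
          gcongr
          exact norm_inverse_one_sub_le_two hkB
      _ = 1000 := by norm_num
  have ha : ‖a z‖ ≤ 400 := by
    calc ‖a z‖ ≤ ‖Q z‖ * ‖v + M (b z)‖ := ContinuousLinearMap.le_opNorm _ _
      _ ≤ 40 * (2 + 4 * ε * 1000) := by
          gcongr
          refine (norm_add_le _ _).trans (add_le_add hv ?_)
          exact (ContinuousLinearMap.le_opNorm _ _).trans (by gcongr)
      _ ≤ 400 := by linarith
  have dR := differentiableAt_resolvent hz
  have dT : DifferentiableAt ℂ T z := ((differentiableAt_const M).mul dR).const_smul (2 : ℂ)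
  have dQ : DifferentiableAt ℂ Q z := dR.mul (dT.inverse_one_sub (by linarith))
  have dMQ : DifferentiableAt ℂ (fun z => M * Q z) z := (differentiableAt_const M).mul dQ
  have dPQ : DifferentiableAt ℂ (fun z => projZero * Q z) z :=
    (differentiableAt_const projZero).mul dQ
  have dB : DifferentiableAt ℂ B z :=
    (((differentiableAt_const _).add
      ((dMQ.mul (differentiableAt_const M)).const_smul (ε : ℂ))).add
        (differentiableAt_const _)).sub
          (((dPQ.mul (differentiableAt_const M)).const_smul (3 : ℂ)).const_smul (g : ℂ))
  have dQv : DifferentiableAt ℂ (fun z => Q z v) z := dQ.clm_apply (differentiableAt_const v)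
  have ds : DifferentiableAt ℂ s z := by
    have h1 : DifferentiableAt ℂ (fun z => M (Q z v)) z :=
      (differentiableAt_const M).clm_apply dQv
    have h2 : DifferentiableAt ℂ (fun z => projZero (Q z v)) z :=
      (differentiableAt_const projZero).clm_apply dQv
    exact ((h1.const_smul (ε : ℂ)).add (differentiableAt_const _)).sub
      ((h2.const_smul (3 : ℂ)).const_smul (g : ℂ))
  have dki : DifferentiableAt ℂ (fun z => (k z)⁻¹) z := hkd.inv hk0
  have db : DifferentiableAt ℂ b z :=
    ((dki.smul dB).inverse_one_sub (by exact hkB.trans_lt (by norm_num))).clm_apply (dki.smul ds)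
  have da : DifferentiableAt ℂ a z :=
    dQ.clm_apply ((differentiableAt_const v).add ((differentiableAt_const M).clm_apply db))
  have hMapp (x : IntEllOne) (m : ℤ) : M x m = w m * x m := by
    rw [hM, weightedShift_apply, add_zero]
  refine ⟨da, db, ha, hb, ⟨Ring.inverse (1 - T z) (v + M (b z)), rfl, fun m => ?_⟩, fun m => ?_⟩
  · have h := congrArg (fun U : IntEllOne →L[ℂ] IntEllOne => U (v + M (b z)) m)
      (Ring.mul_inverse_cancel (1 - T z) (isUnit_one_sub_of_norm_lt_one (by linarith)))
    set c := Ring.inverse (1 - T z) (v + M (b z))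
    change c m - 2 * M (resolvent z c) m = g * unitZero m + M (b z) m at h
    have hac : a z = resolvent z c := rfl
    rw [hMapp, hMapp, ← hac] at h
    linear_combination h
  · have h := congrArg (fun U : IntEllOne →L[ℂ] IntEllOne => U ((k z)⁻¹ • s z) m)
      (Ring.mul_inverse_cancel (1 - (k z)⁻¹ • B z)
        (isUnit_one_sub_of_norm_lt_one (hkB.trans_lt (by norm_num))))
    change b z m - (k z)⁻¹ * B z (b z) m = (k z)⁻¹ * s z m at h
    have h' : k z * b z m = B z (b z) m + s z m := by
      field_simp at h
      linear_combination h
    have hQM : Q z (M (b z)) = a z - Q z v := by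
      rw [← map_sub]; congr 1; abel
    have hB' : B z (b z) m = ε * (shift 1 (b z) m + shift (-1) (b z) m)
        + ε * M (Q z (M (b z))) m + ε * (2 * M (b z) m)
        - g * (3 * (Q z (M (b z)) 0 * unitZero m)) := rfl
    have hs' : s z m = ε * M (Q z v) m + ε * (2 * (g * unitZero m))
        - g * (3 * (Q z v 0 * unitZero m)) := rfl
    have hsub (n : ℤ) : (a z - Q z v) n = a z n - Q z v n := rfl
    rw [h', hB', hs', hQM, hMapp, hMapp, hMapp, hsub, hsub, shift_apply, shift_apply,
      ← sub_eq_add_neg]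
    ring

end IntEllOne

/-- A function close to a quadratic with well separated roots has a zero near each root. -/
theorem exists_zero_near_quadratic_root {G : ℂ → ℂ} {q z₀ z₁ : ℂ} {r η : ℝ} (hr : 0 < r)
    (hη : 0 < η)
    (hd : ∀ z ∈ Metric.closedBall z₀ r, DifferentiableAt ℂ G z)
    (hG : ∀ z ∈ Metric.closedBall z₀ r, ‖G z - q * ((z - z₀) * (z - z₁))‖ ≤ η)
    (hsep : 2 * r ≤ ‖z₀ - z₁‖) (hrη : 2 * η < ‖q‖ * r * (‖z₀ - z₁‖ / 2)) :
    ∃ z ∈ Metric.closedBall z₀ r, G z = 0 := by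
  by_contra! hne
  have hdc : DiffContOnCl ℂ (fun z => (G z)⁻¹) (Metric.ball z₀ r) := by
    refine DifferentiableOn.diffContOnCl fun z hz => ?_
    have hz' := Metric.closure_ball_subset_closedBall hz
    exact ((hd z hz').inv (hne z hz')).differentiableWithinAt
  have hz₀ : z₀ ∈ Metric.closedBall z₀ r := Metric.mem_closedBall_self hr.le
  have hG₀ : ‖G z₀‖ ≤ η := by simpa using hG z₀ hz₀
  set m := ‖q‖ * r * (‖z₀ - z₁‖ / 2)
  have hbd : ∀ z ∈ frontier (Metric.ball z₀ r), ‖(G z)⁻¹‖ ≤ (m - η)⁻¹ := by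
    intro z hz
    rw [frontier_ball z₀ hr.ne'] at hz
    have hzr : ‖z - z₀‖ = r := by simpa [dist_eq_norm] using hz
    have hz1 : ‖z₀ - z₁‖ / 2 ≤ ‖z - z₁‖ := by
      have : ‖z₀ - z₁‖ ≤ ‖z - z₁‖ + ‖z - z₀‖ := by
        calc ‖z₀ - z₁‖ = ‖(z - z₁) - (z - z₀)‖ := by congr 1; ring
          _ ≤ _ := norm_sub_le _ _
      linarith
    have hq : m ≤ ‖q * ((z - z₀) * (z - z₁))‖ := by
      rw [norm_mul, norm_mul, hzr, ← mul_assoc]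
      exact mul_le_mul_of_nonneg_left hz1 (by positivity)
    have h := hG z (Metric.sphere_subset_closedBall hz)
    rw [norm_inv]
    refine inv_anti₀ (by linarith) ?_
    have := norm_sub_norm_le (q * ((z - z₀) * (z - z₁))) (G z)
    rw [norm_sub_rev] at this
    linarith
  have h := Complex.norm_le_of_forall_mem_frontier_norm_le Metric.isBounded_ball hdc hbd
    (subset_closure (Metric.mem_ball_self hr))
  rw [norm_inv] at h
  have hpos : 0 < ‖G z₀‖ := norm_pos_iff.mpr (hne z₀ hz₀)
  have := (inv_le_inv₀ hpos (by linarith)).mp h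
  linarith

/-- The leading-order uniformising coordinate of the resonant eigenvalue, where
`t = 1 - 2δ`. -/
noncomputable def resonantRoot (t : ℝ) : ℂ := ⟨2 * t / 5, -(Real.sqrt (15 - 4 * t ^ 2) / 5)⟩

theorem normSq_resonantRoot {t : ℝ} (ht : t ^ 2 < 15 / 4) :
    Complex.normSq (resonantRoot t) = 3 / 5 := by
  have h := Real.sq_sqrt (show 0 ≤ 15 - 4 * t ^ 2 by linarith)
  rw [resonantRoot, Complex.normSq_mk]
  linear_combination h / 25

theorem resonantRoot_mul_conj {t : ℝ} (ht : t ^ 2 < 15 / 4) :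
    resonantRoot t * (starRingEnd ℂ) (resonantRoot t) = 3 / 5 := by
  rw [Complex.mul_conj, normSq_resonantRoot ht]; norm_num

theorem resonantRoot_add_conj (t : ℝ) :
    resonantRoot t + (starRingEnd ℂ) (resonantRoot t) = 4 * t / 5 := by
  rw [Complex.add_conj, resonantRoot]
  push_cast; ring

theorem norm_resonantRoot_sub_conj (t : ℝ) :
    ‖resonantRoot t - (starRingEnd ℂ) (resonantRoot t)‖ = 2 * Real.sqrt (15 - 4 * t ^ 2) / 5 := by
  rw [Complex.sub_conj, norm_mul, Complex.norm_I, mul_one, Complex.norm_real, resonantRoot,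
    Real.norm_eq_abs, abs_of_nonpos]
  · ring
  · have := Real.sqrt_nonneg (15 - 4 * t ^ 2)
    simp only; linarith

theorem norm_mem_annulus {t : ℝ} (ht : t ^ 2 < 15 / 4) {z : ℂ}
    (hz : ‖z - resonantRoot t‖ ≤ 1 / 50) : 3 / 4 ≤ ‖z‖ ∧ ‖z‖ ≤ 4 / 5 := by
  have h0 : ‖resonantRoot t‖ ^ 2 = 3 / 5 := by
    rw [← Complex.normSq_eq_norm_sq, normSq_resonantRoot ht]
  have hp := norm_nonneg (resonantRoot t)
  have hl : 77 / 100 ≤ ‖resonantRoot t‖ := by nlinarith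
  have hu : ‖resonantRoot t‖ ≤ 78 / 100 := by nlinarith
  have h1 := norm_sub_norm_le z (resonantRoot t)
  have h2 := norm_sub_norm_le (resonantRoot t) z
  rw [norm_sub_rev] at h2
  constructor <;> linarith

namespace IntEllOne

/-- Error bound for the characteristic function `G`, with `a₀, b₀` the values at the origin and
`β = b₁ + b₋₁`. -/
theorem characteristic_error_le {ε g δ : ℝ} {z a₀ b₀ β e : ℂ} (hε : 0 < ε) (hε' : ε ≤ 1 / 2000)
    (ht : (1 - 2 * δ) ^ 2 < 15 / 4) (hz : 3 / 4 ≤ ‖z‖) (hz' : ‖z‖ ≤ 4 / 5)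
    (hg : |g - 1 - 2 * ε| ≤ 8 * ε ^ 2) (ha : ‖a₀‖ ≤ 400) (hβ : ‖β‖ ≤ 4020 * ε)
    (he : ‖e‖ ≤ 300000 * ε) (hae : (1 - z ^ 2) * a₀ = z + e)
    (hb : (3 / 2 + ε * (4 - 2 * δ - z - z⁻¹)) * b₀ = ε * β + g * (2 * ε - 3 * a₀)) :
    ‖(1 - z ^ 2) * (3 / 2 + ε * (4 - 2 * δ - z - z⁻¹)) * ((2 * a₀ + b₀) / ε - 1)
      - (-(5 / 2)) * ((z - resonantRoot (1 - 2 * δ))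
        * (z - (starRingEnd ℂ) (resonantRoot (1 - 2 * δ))))‖ ≤ 4000000 * ε := by
  have hz0 : z ≠ 0 := by
    intro h; rw [h, norm_zero] at hz; linarith
  have hεC : (ε : ℂ) ≠ 0 := by exact_mod_cast hε.ne'
  set h : ℝ := g - 1 - 2 * ε with hh
  have hgh : (g : ℂ) = 1 + 2 * ε + h := by rw [hh]; push_cast; ring
  have hζ : ‖z + z⁻¹‖ ≤ 3 := by
    refine (norm_add_le _ _).trans ?_
    rw [norm_inv]
    have := inv_anti₀ (by norm_num) hz
    norm_num at this; linarith
  have h1 : -2 < 1 - 2 * δ := by nlinarith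
  have h2 : 1 - 2 * δ < 2 := by nlinarith
  have key : (1 - z ^ 2) * (3 / 2 + ε * (4 - 2 * δ - z - z⁻¹)) * ((2 * a₀ + b₀) / ε - 1)
      - (-(5 / 2)) * ((z - resonantRoot (1 - 2 * δ))
        * (z - (starRingEnd ℂ) (resonantRoot (1 - 2 * δ))))
      = 2 * (((1 - 2 * δ : ℝ) : ℂ) - (z + z⁻¹)) * e
        + (1 - z ^ 2) * (β + (4 * ε + 2 * h)
          - ε * (((4 - 2 * δ : ℝ) : ℂ) - (z + z⁻¹)) - ((3 * h / ε : ℝ) : ℂ) * a₀) := by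
    have hprod : (z - resonantRoot (1 - 2 * δ))
        * (z - (starRingEnd ℂ) (resonantRoot (1 - 2 * δ)))
        = z ^ 2 - 4 * (1 - 2 * δ) / 5 * z + 3 / 5 := by
      have e1 := resonantRoot_mul_conj ht
      have e2 := resonantRoot_add_conj (1 - 2 * δ)
      push_cast at e2
      linear_combination e1 - z * e2
    have hb' : (3 / 2 + ε * (4 - 2 * δ - z - z⁻¹)) * ((2 * a₀ + b₀) / ε - 1)
        = (2 * (1 - 2 * δ - (z + z⁻¹))) * a₀ - 3 * h / ε * a₀ + β + 2 * g
          - (3 / 2 + ε * (4 - 2 * δ - z - z⁻¹)) := by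
      rw [mul_sub, mul_div_assoc', mul_add, hb, hgh]
      generalize z⁻¹ = y
      field_simp
      ring
    have hinv : z⁻¹ * z = 1 := inv_mul_cancel₀ hz0
    rw [mul_assoc, hb', hprod, hgh]
    push_cast
    generalize z⁻¹ = y at *
    linear_combination (2 * (1 - 2 * δ - (z + y))) * hae + (-2 : ℂ) * hinv
  rw [key]
  have n1 : ‖((1 - 2 * δ : ℝ) : ℂ) - (z + z⁻¹)‖ ≤ 5 := by
    refine (norm_sub_le _ _).trans ?_
    rw [Complex.norm_real, Real.norm_eq_abs]
    have : |1 - 2 * δ| ≤ 2 := abs_le.mpr ⟨h1.le, h2.le⟩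
    linarith
  have n2 : ‖((4 - 2 * δ : ℝ) : ℂ) - (z + z⁻¹)‖ ≤ 8 := by
    refine (norm_sub_le _ _).trans ?_
    rw [Complex.norm_real, Real.norm_eq_abs]
    have : |4 - 2 * δ| ≤ 5 := abs_le.mpr ⟨by linarith, by linarith⟩
    linarith
  have n3 : ‖1 - z ^ 2‖ ≤ 2 := by
    refine (norm_sub_le _ _).trans ?_
    rw [norm_one, norm_pow]
    nlinarith [norm_nonneg z]
  have n4 : ‖((3 * h / ε : ℝ) : ℂ)‖ ≤ 24 * ε := by
    rw [Complex.norm_real, Real.norm_eq_abs, abs_div, abs_mul, abs_of_pos hε,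
      div_le_iff₀ hε]
    norm_num
    nlinarith
  have n5 : ‖4 * (ε : ℂ) + 2 * h‖ ≤ 5 * ε := by
    have : (4 * (ε : ℂ) + 2 * h) = ((4 * ε + 2 * h : ℝ) : ℂ) := by push_cast; ring
    rw [this, Complex.norm_real, Real.norm_eq_abs]
    have := abs_le.mp hg
    exact abs_le.mpr ⟨by nlinarith, by nlinarith⟩
  have n6 : ‖(ε : ℂ)‖ = ε := by simp [abs_of_pos hε]
  calc _ ≤ ‖2 * (((1 - 2 * δ : ℝ) : ℂ) - (z + z⁻¹)) * e‖
        + ‖1 - z ^ 2‖ * (‖β‖ + ‖4 * (ε : ℂ) + 2 * h‖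
          + ‖(ε : ℂ)‖ * ‖((4 - 2 * δ : ℝ) : ℂ) - (z + z⁻¹)‖ + ‖((3 * h / ε : ℝ) : ℂ)‖ * ‖a₀‖) := by
        refine (norm_add_le _ _).trans ?_
        rw [norm_mul (1 - z ^ 2), ← norm_mul (ε : ℂ), ← norm_mul _ a₀]
        gcongr
        refine (norm_sub_le _ _).trans (add_le_add_left ?_ _)
        refine (norm_sub_le _ _).trans (add_le_add_left ?_ _)
        exact norm_add_le _ _
    _ ≤ 2 * 5 * (300000 * ε) + 2 * (4020 * ε + 5 * ε + ε * 8 + 24 * ε * 400) := by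
        rw [norm_mul, norm_mul, Complex.norm_ofNat, n6]
        gcongr
    _ ≤ 4000000 * ε := by linarith

/-- Existence of the resonant mode: a root `z` of the characteristic function near the leading-order
root, together with the summable components `a`, `b` of the mode. -/
theorem exists_resonant_mode {w : ℤ → ℂ} {ε g δ r : ℝ} (hε : 0 < ε) (hε' : ε ≤ 1 / 2000)
    (ht : (1 - 2 * δ) ^ 2 < 15 / 4) (hw : ∀ m, ‖w m‖ ≤ 4 * ε) (hw0 : w 0 = 0)
    (hg : |g - 1 - 2 * ε| ≤ 8 * ε ^ 2) (hr : 0 < r) (hr' : r ≤ 1 / 50)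
    (hsep : r ≤ Real.sqrt (15 - 4 * (1 - 2 * δ) ^ 2) / 5)
    (hrε : 16000000 * ε < r * Real.sqrt (15 - 4 * (1 - 2 * δ) ^ 2)) :
    ∃ z : ℂ, ‖z - resonantRoot (1 - 2 * δ)‖ ≤ r ∧ ∃ a b : IntEllOne,
      2 * a 0 + b 0 = ε ∧
      (∀ m, ε * ((z + z⁻¹) * a m - a (m + 1) - a (m - 1))
        = ((if m = 0 then (g : ℂ) else 0) + ε * w m) * (2 * a m + b m)) ∧
      (∀ m, (3 / 2 + ε * (4 - 2 * δ - z - z⁻¹)) * b m - ε * (b (m + 1) + b (m - 1))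
        = ((if m = 0 then (g : ℂ) else 0) + ε * w m) * (a m + 2 * b m)) := by
  have hεC : ‖(ε : ℂ)‖ = ε := by simp [abs_of_pos hε]
  have hε0 : (ε : ℂ) ≠ 0 := by exact_mod_cast hε.ne'
  have hgab := abs_le.mp hg
  have hg1 : |g - 1| ≤ 3 * ε := abs_le.mpr ⟨by nlinarith, by nlinarith⟩
  have hg1' := abs_le.mp hg1
  have hg2 : |g| ≤ 2 := abs_le.mpr ⟨by linarith, by linarith⟩
  let k : ℂ → ℂ := fun z => 3 / 2 + ε * (4 - 2 * δ - z - z⁻¹)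
  obtain ⟨a, b, hab⟩ := exists_analytic_solution (k := k) hε hε' hw hg2
  set z₀ := resonantRoot (1 - 2 * δ) with hz₀
  have hann : ∀ z ∈ Metric.closedBall z₀ r, 3 / 4 ≤ ‖z‖ ∧ ‖z‖ ≤ 4 / 5 := fun z hz =>
    norm_mem_annulus ht ((mem_closedBall_iff_norm.mp hz).trans hr')
  have hne : ∀ z ∈ Metric.closedBall z₀ r, z ≠ 0 := by
    rintro z hz rfl
    have := (hann 0 hz).1
    rw [norm_zero] at this; linarith
  have hkd : ∀ z ∈ Metric.closedBall z₀ r, DifferentiableAt ℂ k z := fun z hz => by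
    have := hne z hz
    exact (differentiableAt_const _).add ((((differentiableAt_const _).sub
      differentiableAt_id).sub (differentiableAt_inv this)).const_mul _)
  have hk1 : ∀ z ∈ Metric.closedBall z₀ r, 1 ≤ ‖k z‖ := fun z hz => by
    obtain ⟨hz1, hz2⟩ := hann z hz
    have h1 : -2 < 1 - 2 * δ := by nlinarith
    have h2 : 1 - 2 * δ < 2 := by nlinarith
    have n2 : ‖((4 - 2 * δ : ℝ) : ℂ) - z - z⁻¹‖ ≤ 8 := by
      have hi : ‖z⁻¹‖ ≤ 4 / 3 := by
        rw [norm_inv]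
        have := inv_anti₀ (by norm_num) hz1
        norm_num at this ⊢; linarith
      have : ‖((4 - 2 * δ : ℝ) : ℂ)‖ ≤ 5 := by
        rw [Complex.norm_real, Real.norm_eq_abs]
        exact abs_le.mpr ⟨by linarith, by linarith⟩
      have := norm_sub_le (((4 - 2 * δ : ℝ) : ℂ) - z) z⁻¹
      have := norm_sub_le ((4 - 2 * δ : ℝ) : ℂ) z
      linarith
    have h3 : ‖(ε : ℂ) * (((4 - 2 * δ : ℝ) : ℂ) - z - z⁻¹)‖ ≤ ε * 8 := by
      rw [norm_mul, hεC]; gcongr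
    have h4 : k z = 3 / 2 + (ε : ℂ) * (((4 - 2 * δ : ℝ) : ℂ) - z - z⁻¹) := by
      simp only [k]; push_cast; rfl
    have h5 := norm_le_norm_add_norm_sub' (3 / 2 : ℂ) (k z)
    rw [h4, ← norm_neg (_ - _), neg_sub, add_sub_cancel_left, ← h4] at h5
    norm_num at h5
    norm_num at h3
    linarith
  let G : ℂ → ℂ := fun z => (1 - z ^ 2) * k z * ((2 * a z 0 + b z 0) / ε - 1)
  have hGd : ∀ z ∈ Metric.closedBall z₀ r, DifferentiableAt ℂ G z := fun z hz => by
    obtain ⟨da, db, -⟩ := hab z (hann z hz).2 (hkd z hz) (hk1 z hz)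
    have da0 : DifferentiableAt ℂ (fun z => a z 0) z :=
      (differentiableAt_const evalZero).clm_apply da
    have db0 : DifferentiableAt ℂ (fun z => b z 0) z :=
      (differentiableAt_const evalZero).clm_apply db
    exact (((differentiableAt_const _).sub (differentiableAt_id.pow 2)).mul (hkd z hz)).mul
      ((((da0.const_mul 2).add db0).div_const _).sub_const _)
  have hGe : ∀ z ∈ Metric.closedBall z₀ r,
      ‖G z - (-(5 / 2)) * ((z - z₀) * (z - (starRingEnd ℂ) z₀))‖ ≤ 4000000 * ε := fun z hz => by
    obtain ⟨hz1, hz2⟩ := hann z hz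
    obtain ⟨-, -, ha, hb, ⟨c, hac, hc⟩, hbe⟩ := hab z hz2 (hkd z hz) (hk1 z hz)
    have hbm : ∀ m, m ≠ 0 → ‖b z m‖ ≤ 2010 * ε := fun m hm => by
      have h := hbe m
      rw [unitZero_apply, if_neg hm, mul_zero, add_zero] at h
      calc ‖b z m‖ ≤ ‖k z‖ * ‖b z m‖ := le_mul_of_one_le_left (norm_nonneg _) (hk1 z hz)
        _ = ‖ε * (b z (m + 1) + b z (m - 1)) + ε * (w m * (a z m + 2 * b z m))‖ := by
            rw [← norm_mul, h]
        _ ≤ ε * (1000 + 1000) + ε * (4 * ε * (400 + 2 * 1000)) := by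
            refine (norm_add_le _ _).trans ?_
            rw [norm_mul, norm_mul, norm_mul, hεC]
            have hA := fun n => (norm_coord_le (a z) n).trans ha
            have hB := fun n => (norm_coord_le (b z) n).trans hb
            gcongr
            · exact (norm_add_le _ _).trans (add_le_add (hB _) (hB _))
            · exact hw m
            · refine (norm_add_le _ _).trans (add_le_add (hA _) ?_)
              rw [norm_mul, Complex.norm_ofNat]
              gcongr
              exact hB _
        _ ≤ 2010 * ε := by nlinarith
    have hβ : ‖b z (0 + 1) + b z (0 - 1)‖ ≤ 4020 * ε := by
      refine (norm_add_le _ _).trans ?_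
      have := hbm (0 + 1) (by norm_num)
      have := hbm (0 - 1) (by norm_num)
      linarith
    have hcn : ‖c - unitZero‖ ≤ 7203 * ε := by
      have hce : c - unitZero = ((g - 1 : ℝ) : ℂ) • unitZero
          + weightedShift w (4 * ε) hw 0 ((2 : ℂ) • a z + b z) := by
        apply lp.ext; funext m
        change c m - unitZero m = ((g - 1 : ℝ) : ℂ) * unitZero m
          + w m * (2 * a z (m + 0) + b z (m + 0))
        rw [hc, add_zero]; push_cast; ring
      rw [hce]
      refine (norm_add_le _ _).trans ?_
      have e1 : ‖((g - 1 : ℝ) : ℂ) • unitZero‖ ≤ 3 * ε := by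
        rw [norm_smul, norm_unitZero, mul_one, Complex.norm_real]; exact hg1
      have e2 : ‖weightedShift w (4 * ε) hw 0 ((2 : ℂ) • a z + b z)‖
          ≤ 4 * ε * (2 * 400 + 1000) := by
        refine (ContinuousLinearMap.le_opNorm _ _).trans ?_
        gcongr
        · exact norm_weightedShift_le _ _ _ _
        · refine (norm_add_le _ _).trans (add_le_add ?_ hb)
          rw [norm_smul, Complex.norm_ofNat]; gcongr
      linarith
    have hae : (1 - z ^ 2) * a z 0 = z + (1 - z ^ 2) * resolvent z (c - unitZero) 0 := by
      have h1 : resolvent z (c - unitZero) 0 = a z 0 - resolvent z unitZero 0 := by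
        rw [map_sub, hac]; rfl
      rw [h1]
      linear_combination resolvent_unitZero_zero hz2
    refine characteristic_error_le hε hε' ht hz1 hz2 hg ((norm_coord_le _ 0).trans ha) hβ ?_ hae ?_
    · rw [norm_mul]
      have n3 : ‖1 - z ^ 2‖ ≤ 2 := by
        refine (norm_sub_le _ _).trans ?_
        rw [norm_one, norm_pow]
        nlinarith [norm_nonneg z]
      calc _ ≤ 2 * (20 * (7203 * ε)) := by
            gcongr
            refine (norm_coord_le _ 0).trans ((ContinuousLinearMap.le_opNorm _ _).trans ?_)
            gcongr
            exact norm_resolvent_le hz2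
        _ ≤ 300000 * ε := by linarith
    · have h := hbe 0
      rw [unitZero_apply, if_pos rfl, hw0] at h
      simp only [k] at h
      rw [h]; ring
  obtain ⟨z, hz, hGz⟩ := exists_zero_near_quadratic_root hr (by positivity : 0 < 4000000 * ε)
    hGd hGe (by rw [hz₀, norm_resonantRoot_sub_conj]; linarith)
    (by rw [hz₀, norm_resonantRoot_sub_conj]; norm_num; linarith)
  obtain ⟨hz1, hz2⟩ := hann z hz
  obtain ⟨-, -, ha, hb, ⟨c, hac, hc⟩, hbe⟩ := hab z hz2 (hkd z hz) (hk1 z hz)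
  have hzn := hne z hz
  have hkn : k z ≠ 0 := fun h => by
    have := hk1 z hz
    rw [h, norm_zero] at this; linarith
  have hz21 : 1 - z ^ 2 ≠ 0 := fun h => by
    have h1 : ‖z ^ 2‖ = 1 := by rw [← sub_eq_zero.mp h, norm_one]
    rw [norm_pow] at h1
    nlinarith
  have hres : 2 * a z 0 + b z 0 = ε := by
    have h := (mul_eq_zero.mp hGz).resolve_left (mul_ne_zero hz21 hkn)
    rw [sub_eq_zero, div_eq_iff hε0, one_mul] at h
    exact h
  refine ⟨z, mem_closedBall_iff_norm.mp hz, a z, b z, hres, fun m => ?_, fun m => ?_⟩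
  · have h := resolvent_equation hz2 c m
    rw [← hac, hc, unitZero_apply] at h
    have hinv : z * z⁻¹ = 1 := mul_inv_cancel₀ hzn
    apply mul_left_cancel₀ hzn
    by_cases hm : m = 0
    · subst hm
      simp only [if_true] at h ⊢
      linear_combination (ε : ℂ) * h + (ε : ℂ) * a z 0 * hinv - z * g * hres
    · simp only [if_neg hm] at h ⊢
      linear_combination (ε : ℂ) * h + (ε : ℂ) * a z m * hinv
  · have h := hbe m
    rw [unitZero_apply] at h
    by_cases hm : m = 0
    · subst hm
      simp only [if_true, k] at h ⊢
      linear_combination h - 2 * (g : ℂ) * hres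
    · simp only [if_neg hm, k] at h ⊢
      linear_combination h

end IntEllOne

theorem abs_sub_delta_le {ψ : ℤ → ℝ} {ρ : ℝ} (hψ : Memℓp ψ 2)
    (h : Real.sqrt (∑' m : ℤ, (ψ m - if m = 0 then 1 else 0) ^ 2) ≤ ρ) (m : ℤ) :
    |ψ m - if m = 0 then 1 else 0| ≤ ρ := by
  have hmem : Memℓp (fun m : ℤ => ψ m - if m = 0 then 1 else 0) 2 := by
    have h1 := hψ.sub (lp.memℓp (lp.single (E := fun _ : ℤ => ℝ) 2 0 1))
    convert h1 using 1
    funext m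
    simp [Pi.single_apply]
  have hsum : Summable fun m : ℤ => (ψ m - if m = 0 then 1 else 0) ^ 2 := by
    simpa using hmem.summable (by simp)
  refine le_trans ?_ h
  rw [← Real.sqrt_sq_eq_abs]
  exact Real.sqrt_le_sqrt (hsum.le_tsum m fun _ _ => sq_nonneg _)

theorem abs_sq_zero_sub_le {ψ : ℤ → ℝ} {ε : ℝ} (hε : 0 < ε) (hε' : ε ≤ 1 / 4)
    (heq : -ψ 0 + ε * (ψ (0 + 1) + ψ (0 - 1) - 2 * ψ 0) + (ψ 0) ^ 3 = 0)
    (hψ : ∀ m : ℤ, |ψ m - if m = 0 then 1 else 0| ≤ 2 * ε) :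
    |ψ 0 ^ 2 - 1 - 2 * ε| ≤ 8 * ε ^ 2 := by
  have h0 : |ψ 0 - 1| ≤ 2 * ε := by simpa using hψ 0
  have h1 : |ψ 1| ≤ 2 * ε := by simpa using hψ 1
  have h2 : |ψ (-1)| ≤ 2 * ε := by simpa using hψ (-1)
  have hψ0 : 1 / 2 ≤ ψ 0 := by
    have := (abs_le.mp h0).1
    linarith
  have h3 : |ψ 0 * (ψ 0 ^ 2 - 1 - 2 * ε)| ≤ ε * (2 * ε + 2 * ε) := by
    have : ψ 0 * (ψ 0 ^ 2 - 1 - 2 * ε) = -(ε * (ψ 1 + ψ (-1))) := by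
      simp only [zero_add, zero_sub] at heq
      linear_combination heq
    rw [this, abs_neg, abs_mul, abs_of_pos hε]
    gcongr
    exact (abs_add_le _ _).trans (add_le_add h1 h2)
  rw [abs_mul, abs_of_pos (by linarith)] at h3
  nlinarith [abs_nonneg (ψ 0 ^ 2 - 1 - 2 * ε)]

theorem norm_add_inv_sub_add_inv_le {z z₀ : ℂ} (hz : 3 / 4 ≤ ‖z‖) (hz₀ : 3 / 4 ≤ ‖z₀‖) :
    ‖(z + z⁻¹) - (z₀ + z₀⁻¹)‖ ≤ 3 * ‖z - z₀‖ := by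
  have h1 : z ≠ 0 := norm_pos_iff.mp (by linarith)
  have h2 : z₀ ≠ 0 := norm_pos_iff.mp (by linarith)
  have h3 : (z + z⁻¹) - (z₀ + z₀⁻¹) = (1 - z⁻¹ * z₀⁻¹) * (z - z₀) := by
    field_simp; ring
  have hi {u : ℂ} (hu : 3 / 4 ≤ ‖u‖) : ‖u⁻¹‖ ≤ 4 / 3 := by
    rw [norm_inv]
    have := inv_anti₀ (by norm_num) hu
    norm_num at this ⊢; linarith
  rw [h3, norm_mul]
  gcongr
  refine (norm_sub_le _ _).trans ?_
  rw [norm_one, norm_mul]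
  have : ‖z⁻¹‖ * ‖z₀⁻¹‖ ≤ 4 / 3 * (4 / 3) := by
    gcongr
    · exact hi hz
    · exact hi hz₀
  linarith

theorem resonantRoot_add_inv {t : ℝ} (ht : t ^ 2 < 15 / 4) :
    resonantRoot t + (resonantRoot t)⁻¹
      = 16 * t / 15 + (2 / 15 * Real.sqrt (15 - 4 * t ^ 2) : ℝ) * Complex.I := by
  rw [Complex.inv_def, normSq_resonantRoot ht]
  apply Complex.ext
  · simp [resonantRoot]; ring
  · simp [resonantRoot]; ring

theorem exists_pos_le_sqrt {K : Set ℝ} (hK : IsCompact K)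
    (hKsub : K ⊆ {δ : ℝ | (1 - 2 * δ) ^ 2 < 15 / 4}) :
    ∃ σ : ℝ, 0 < σ ∧ ∀ δ ∈ K, σ ≤ Real.sqrt (15 - 4 * (1 - 2 * δ) ^ 2) := by
  rcases K.eq_empty_or_nonempty with rfl | hne
  · exact ⟨1, one_pos, by simp⟩
  · obtain ⟨δ₀, hδ₀, hmin⟩ := hK.exists_isMinOn hne
      (f := fun δ => Real.sqrt (15 - 4 * (1 - 2 * δ) ^ 2)) (by fun_prop)
    have h : (1 - 2 * δ₀) ^ 2 < 15 / 4 := hKsub hδ₀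
    exact ⟨_, Real.sqrt_pos.mpr (by linarith), fun δ hδ => hmin hδ⟩

/-- Theorem 4 (transverse instability on the stripe lattice with `κ = -1`). For small
`ε > 0`, scaled detuning `δ` in a compact subset of `{δ : (1-2δ)² < 15/4}`, transverse
wavenumber `p = √(1/4 + εδ)`, and the fundamental soliton `ψ ≈ e₀` (with `μ = 1`),
the stripe-lattice stability problem with `κ = -1` admits a complex eigenvalue `λ`
with `Re λ > 0`, `Im λ > 0`, and
`λ = (3/4)i + (iε/15)(14 + 17δ) + (2ε/15)√(15 - 4(1-2δ)²) + O(ε²)`. -/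
theorem transverse_instability_stripe_kappa_minus (K : Set ℝ)
    (hKcompact : IsCompact K) (hKsub : K ⊆ {δ : ℝ | (1 - 2 * δ) ^ 2 < 15 / 4}) :
    ∃ ε₀ C : ℝ, 0 < ε₀ ∧ 0 < C ∧
      ∀ ε : ℝ, 0 < ε → ε < ε₀ →
      ∀ δ : ℝ, δ ∈ K →
      ∀ ψ : ℤ → ℝ, Memℓp ψ 2 → (∀ m : ℤ, 0 < ψ m) →
      (∀ m : ℤ, -ψ m + ε * (ψ (m + 1) + ψ (m - 1) - 2 * ψ m) + (ψ m) ^ 3 = 0) →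
      Real.sqrt (∑' m : ℤ, (ψ m - if m = 0 then 1 else 0) ^ 2) ≤ 2 * ε →
      ∀ p : ℝ, p = Real.sqrt (1 / 4 + ε * δ) →
      ∃ lam : ℂ, 0 < lam.re ∧ 0 < lam.im ∧
        (∃ U W : ℤ → ℂ, Memℓp U 2 ∧ Memℓp W 2 ∧ ¬(U = 0 ∧ W = 0) ∧
          (∀ m : ℤ, -(ε : ℂ) * (U (m + 1) + U (m - 1) - 2 * U m)
            + (1 - (p : ℂ) ^ 2) * U m - 3 * ((ψ m : ℝ) : ℂ) ^ 2 * U m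
            = (-lam) * W m) ∧
          (∀ m : ℤ, -(ε : ℂ) * (W (m + 1) + W (m - 1) - 2 * W m)
            + (1 - (p : ℂ) ^ 2) * W m - ((ψ m : ℝ) : ℂ) ^ 2 * W m
            = lam * U m)) ∧
        ‖lam - (((3 / 4 : ℝ) : ℂ) * Complex.I
          + ((ε / 15 * (14 + 17 * δ) : ℝ) : ℂ) * Complex.I
          + ((2 * ε / 15 * Real.sqrt (15 - 4 * (1 - 2 * δ) ^ 2) : ℝ) : ℂ))‖
          ≤ C * ε ^ 2 := by
  obtain ⟨σ, hσ, hσK⟩ := exists_pos_le_sqrt hKcompact hKsub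
  set A : ℝ := 20000000 / σ with hA
  have hApos : 0 < A := by positivity
  have hAσ : A * σ = 20000000 := by rw [hA]; field_simp
  refine ⟨min (1 / 2000) (min (1 / (50 * A)) (σ / (30 * A))), 3 * A, by positivity, by positivity,
    fun ε hε hεlt δ hδ ψ hψ hψpos heq hnorm p hp => ?_⟩
  obtain ⟨hε1, hε2, hε3⟩ := by simpa only [lt_min_iff] using hεlt
  rw [lt_div_iff₀ (by positivity)] at hε2 hε3
  have ht : (1 - 2 * δ) ^ 2 < 15 / 4 := hKsub hδ
  have hσδ := hσK δ hδ
  have hψd := abs_sub_delta_le hψ hnorm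
  have hg := abs_sq_zero_sub_le hε (by linarith) (heq 0) hψd
  have hεC : (ε : ℂ) ≠ 0 := by exact_mod_cast hε.ne'
  let w : ℤ → ℂ := fun m => if m = 0 then 0 else ((ψ m ^ 2 / ε : ℝ) : ℂ)
  have hw : ∀ m, ‖w m‖ ≤ 4 * ε := fun m => by
    by_cases hm : m = 0
    · simp only [w, if_pos hm, norm_zero]; positivity
    · have h := hψd m
      rw [if_neg hm, sub_zero] at h
      simp only [w, if_neg hm, Complex.norm_real, Real.norm_eq_abs]
      rw [abs_of_nonneg (by positivity), div_le_iff₀ hε, ← sq_abs]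
      nlinarith [abs_nonneg (ψ m)]
  have hV : ∀ m, (if m = 0 then ((ψ 0 ^ 2 : ℝ) : ℂ) else 0) + ε * w m = (ψ m : ℂ) ^ 2 := fun m => by
    by_cases hm : m = 0
    · subst hm; simp [w]
    · simp only [w, if_neg hm]
      push_cast; field_simp; ring
  obtain ⟨z, hz, a, b, hres, ha, hb⟩ := IntEllOne.exists_resonant_mode (r := A * ε) hε hε1.le ht hw
    (by simp [w]) hg (by positivity) (by linarith) (by linarith) (by
      have : A * ε * σ ≤ A * ε * Real.sqrt (15 - 4 * (1 - 2 * δ) ^ 2) := by gcongr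
      have : A * ε * σ = 20000000 * ε := by rw [mul_right_comm, hAσ]
      linarith)
  simp only [hV] at ha hb
  have h1 : -2 < 1 - 2 * δ := by nlinarith
  have h2 : 1 - 2 * δ < 2 := by nlinarith
  have hp2 : (p : ℂ) ^ 2 = 1 / 4 + ε * δ := by
    have : p ^ 2 = 1 / 4 + ε * δ := by
      rw [hp, Real.sq_sqrt]; nlinarith
    rw [← Complex.ofReal_pow, this]; push_cast; rfl
  have hpz := (norm_mem_annulus ht (hz.trans (by linarith))).1
  have hpz₀ := (norm_mem_annulus ht (z := resonantRoot (1 - 2 * δ)) (by simp)).1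
  have hζ := norm_add_inv_sub_add_inv_le hpz hpz₀
  rw [resonantRoot_add_inv ht] at hζ
  set s := Real.sqrt (15 - 4 * (1 - 2 * δ) ^ 2)
  set lam : ℂ := Complex.I * (3 / 4 - ε * δ + 2 * ε - ε * (z + z⁻¹)) with hlam
  have hI : Complex.I ^ 2 = -1 := Complex.I_sq
  have hest : ‖lam - (((3 / 4 : ℝ) : ℂ) * Complex.I
      + ((ε / 15 * (14 + 17 * δ) : ℝ) : ℂ) * Complex.I
      + ((2 * ε / 15 * s : ℝ) : ℂ))‖ ≤ 3 * A * ε ^ 2 := by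
    have he : lam - (((3 / 4 : ℝ) : ℂ) * Complex.I
        + ((ε / 15 * (14 + 17 * δ) : ℝ) : ℂ) * Complex.I + ((2 * ε / 15 * s : ℝ) : ℂ))
        = -(Complex.I * ε * ((z + z⁻¹) - (16 * ((1 - 2 * δ : ℝ) : ℂ) / 15
          + (2 / 15 * s : ℝ) * Complex.I))) := by
      rw [hlam]; push_cast
      linear_combination -(2 / 15 * ε * s : ℂ) * hI
    rw [he, norm_neg, norm_mul, norm_mul, Complex.norm_I, one_mul, Complex.norm_real,
      Real.norm_eq_abs, abs_of_pos hε]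
    nlinarith
  have hre := (Complex.abs_re_le_norm _).trans hest
  have him := (Complex.abs_im_le_norm _).trans hest
  simp only [Complex.sub_re, Complex.sub_im, Complex.add_re, Complex.add_im, Complex.re_ofReal_mul,
    Complex.im_ofReal_mul, Complex.I_re, Complex.I_im, Complex.ofReal_re, Complex.ofReal_im,
    mul_zero, mul_one, zero_add, add_zero] at hre him
  refine ⟨lam, ?_, ?_, ?_, hest⟩
  · have := (abs_le.mp hre).1
    have : ε * (ε * (30 * A)) < ε * s := by gcongr; linarith
    nlinarith
  · have := (abs_le.mp him).1
    nlinarith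
  · refine ⟨fun m => (a m + b m) / 2, fun m => Complex.I * (a m - b m) / 2, ?_, ?_, ?_,
      fun m => ?_, fun m => ?_⟩
    · have h := ((1 / 2 : ℂ) • (a + b)).memℓp_two
      rwa [show ⇑((1 / 2 : ℂ) • (a + b)) = fun m => (a m + b m) / 2 from
        funext fun m => one_div_mul_eq_div _ _] at h
    · have h := ((Complex.I / 2) • (a - b)).memℓp_two
      rwa [show ⇑((Complex.I / 2) • (a - b)) = fun m => Complex.I * (a m - b m) / 2 from
        funext fun m => div_mul_eq_mul_div _ _ _] at h
    · rintro ⟨hU, hW⟩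
      have hU0 : (a 0 + b 0) / 2 = 0 := congrFun hU 0
      have hW0 : Complex.I * (a 0 - b 0) / 2 = 0 := congrFun hW 0
      apply hεC
      rw [← hres]
      linear_combination (3 : ℂ) * hU0 - Complex.I * hW0 + (a 0 - b 0) / 2 * hI
    · rw [hp2, hlam]
      linear_combination (1 / 2 : ℂ) * ha m + (1 / 2 : ℂ) * hb m
        + (3 / 4 - ε * δ + 2 * ε - ε * (z + z⁻¹)) * (a m - b m) / 2 * hI
    · rw [hp2, hlam]
      linear_combination (Complex.I / 2) * ha m - (Complex.I / 2) * hb m
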